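/- For every n ≥ 1, the operators P_k := (1/[n choose k])·E^{(k)}∘F^{(k)} intertwine the quantum sl₂ action: for 0 ≤ k ≤ n−1, E∘P_k = P_{k+1}∘E as maps W_k → W_{k+1}, and for 1 ≤ k ≤ n, F∘P_k = P_{k−1}∘F as maps W_k → W_{k−1}. (Together with idempotency and annihilation by the Temperley-Lieb operators, this identifies P_k with the restriction of the Jones-Wenzl projector p_n to W_k.) -/

import Mathlib

set_option maxHeartbeats 1000000
set_option synthInstance.maxHeartbeats 400000

/-! Common setup: `Fq = ℚ(q)`, the tensor power `V^{⊗n}` of `V = Fq²` realized as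
functions on the set of `{0,1}`-sequences (its standard basis), the Temperley-Lieb
and braid operators `U_i, t_i, t_i'`, the quantum `sl₂` operators `E, F, K^{⊗n}`,
weight spaces, quantum integers and the Jones-Wenzl operators. -/

noncomputable section

/-- The field `ℚ(q)` of rational functions. -/
abbrev Fq := RatFunc ℚ

/-- The variable `q`. -/
def q : Fq := RatFunc.X

/-- `V^{⊗n}` for `V = Fq²`: functions on the index set of the standard basis
`v_{i₁} ⊗ ⋯ ⊗ v_{iₙ}`, `i_r ∈ {0,1}` (here `false ↔ v₀`, `true ↔ v₁`). -/
abbrev Tens (n : ℕ) := (Fin n → Bool) → Fq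

/-- Coefficients of `Ũ` on `V ⊗ V`: `uCoef a b c d` is the coefficient of
`v_c ⊗ v_d` in `Ũ(v_a ⊗ v_b)`. -/
def uCoef : Bool → Bool → Bool → Bool → Fq
  | false, true, true, false => 1
  | false, true, false, true => -q
  | true, false, true, false => -q⁻¹
  | true, false, false, true => 1
  | _, _, _, _ => 0

/-- Coefficients of `t̃` on `V ⊗ V`. -/
def tCoef : Bool → Bool → Bool → Bool → Fq
  | false, false, false, false => 1
  | true, true, true, true => 1
  | false, true, true, false => q
  | false, true, false, true => 1 - q ^ 2
  | true, false, false, true => q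
  | _, _, _, _ => 0

/-- Coefficients of `t̃′` on `V ⊗ V`. -/
def tpCoef : Bool → Bool → Bool → Bool → Fq
  | false, false, false, false => 1
  | true, true, true, true => 1
  | false, true, true, false => q⁻¹
  | true, false, true, false => 1 - (q ^ 2)⁻¹
  | true, false, false, true => q⁻¹
  | _, _, _, _ => 0

/-- Matrix of the operator `id^{⊗(i-1)} ⊗ T ⊗ id^{⊗(n-i-1)}` acting on the
(1-based) tensor factors `i, i+1` of `V^{⊗n}`, where `T` has coefficient matrix `m`:
the `(t, s)` entry is the coefficient of the basis vector indexed by `t` in the image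
of the basis vector indexed by `s`. -/
def locMat (n : ℕ) (m : Bool → Bool → Bool → Bool → Fq) (i : ℕ) :
    Matrix (Fin n → Bool) (Fin n → Bool) Fq := fun t s =>
  if h : 1 ≤ i ∧ i < n then
    let i0 : Fin n := ⟨i - 1, by omega⟩
    let i1 : Fin n := ⟨i, by omega⟩
    if s = Function.update (Function.update t i0 (s i0)) i1 (s i1) then
      m (s i0) (s i1) (t i0) (t i1)
    else 0
  else 0

/-- The Temperley-Lieb operator `U_i = id^{⊗(i-1)} ⊗ Ũ ⊗ id^{⊗(n-i-1)}` (1-based `i`). -/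
def Uop (n i : ℕ) : Module.End Fq (Tens n) := (locMat n uCoef i).mulVecLin

/-- The braid operator `t_i = id^{⊗(i-1)} ⊗ t̃ ⊗ id^{⊗(n-i-1)}` (1-based `i`). -/
def tOp (n i : ℕ) : Module.End Fq (Tens n) := (locMat n tCoef i).mulVecLin

/-- The inverse braid operator `t_i′ = id^{⊗(i-1)} ⊗ t̃′ ⊗ id^{⊗(n-i-1)}` (1-based `i`). -/
def tpOp (n i : ℕ) : Module.End Fq (Tens n) := (locMat n tpCoef i).mulVecLin

/-- Number of indices `r` with `i_r = 1` in the basis index `s`. -/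
def countOnes {n : ℕ} (s : Fin n → Bool) : ℕ := (Finset.univ.filter fun r => s r = true).card

/-- The weight space `W_k = V₁^{⊗n}[-n+2k]`: the span of the standard basis vectors
with exactly `k` of the `i_r` equal to `1`. -/
def weightSpace (n k : ℕ) : Submodule Fq (Tens n) :=
  Submodule.span Fq {ψ : Tens n | ∃ s : Fin n → Bool, countOnes s = k ∧ ψ = Pi.single s 1}

/-- Eigenvalue of `K` on `v_b`. -/
def kval (b : Bool) : Fq := if b then q else q⁻¹

/-- Matrix of `E = Σ_j K^{⊗(j-1)} ⊗ e ⊗ id^{⊗(n-j)}` on `V^{⊗n}`. -/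
def Emat (n : ℕ) : Matrix (Fin n → Bool) (Fin n → Bool) Fq := fun t s =>
  ∑ j : Fin n,
    if s j = false ∧ t = Function.update s j true then
      ∏ r ∈ Finset.univ.filter fun r => r < j, kval (s r)
    else 0

/-- Matrix of `F = Σ_j id^{⊗(j-1)} ⊗ f ⊗ (K⁻¹)^{⊗(n-j)}` on `V^{⊗n}`. -/
def Fmat (n : ℕ) : Matrix (Fin n → Bool) (Fin n → Bool) Fq := fun t s =>
  ∑ j : Fin n,
    if s j = true ∧ t = Function.update s j false then
      ∏ r ∈ Finset.univ.filter fun r => j < r, (kval (s r))⁻¹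
    else 0

/-- The operator `E` on `V^{⊗n}`. -/
def Eop (n : ℕ) : Module.End Fq (Tens n) := (Emat n).mulVecLin

/-- The operator `F` on `V^{⊗n}`. -/
def Fop (n : ℕ) : Module.End Fq (Tens n) := (Fmat n).mulVecLin

/-- The operator `𝐊 = K^{⊗n}` on `V^{⊗n}`. -/
def Kop (n : ℕ) : Module.End Fq (Tens n) :=
  (Matrix.diagonal fun s : Fin n → Bool => ∏ r, kval (s r)).mulVecLin

/-- The operator `𝐊⁻¹ = (K⁻¹)^{⊗n}` on `V^{⊗n}`. -/
def Kinvop (n : ℕ) : Module.End Fq (Tens n) :=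
  (Matrix.diagonal fun s : Fin n → Bool => (∏ r, kval (s r))⁻¹).mulVecLin

/-- The quantum integer `[m] = (q^m - q^{-m})/(q - q⁻¹)`. -/
def qint (m : ℕ) : Fq := (q ^ m - q⁻¹ ^ m) / (q - q⁻¹)

/-- The quantum factorial `[m]! = [1][2]⋯[m]`. -/
def qfact (m : ℕ) : Fq := ∏ i ∈ Finset.range m, qint (i + 1)

/-- The quantum binomial coefficient `[n choose k] = [n]!/([k]!·[n-k]!)`. -/
def qbinom (n k : ℕ) : Fq := qfact n / (qfact k * qfact (n - k))

/-- The divided power `E^{(k)} = E^k/[k]!`. -/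
def Ediv (n k : ℕ) : Module.End Fq (Tens n) := (qfact k)⁻¹ • (Eop n) ^ k

/-- The divided power `F^{(k)} = F^k/[k]!`. -/
def Fdiv (n k : ℕ) : Module.End Fq (Tens n) := (qfact k)⁻¹ • (Fop n) ^ k

/-- The operator `P_k = (1/[n choose k])·E^{(k)} ∘ F^{(k)}` (the Jones-Wenzl projector
on the weight space `W_k`). -/
def JW (n k : ℕ) : Module.End Fq (Tens n) := (qbinom n k)⁻¹ • (Ediv n k ∘ₗ Fdiv n k)

/-- The vectors `l_r` (1-based): `l_r = v₀^{⊗(r-1)} ⊗ (v₁⊗v₀ - q·v₀⊗v₁) ⊗ v₀^{⊗(n-r-1)}`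
for `r ≠ n`, and `l_n = v₀^{⊗(n-1)} ⊗ v₁`. -/
def ell (n j : ℕ) : Tens n :=
  if j = n then Pi.single (fun r => decide (r.val = n - 1)) 1
  else (Pi.single (fun r => decide (r.val = j - 1)) 1 : Tens n)
      - q • (Pi.single (fun r => decide (r.val = j)) 1 : Tens n)

/-- The span of `l_1, …, l_n`. -/
def ellSpan (n : ℕ) : Submodule Fq (Tens n) :=
  Submodule.span Fq {v : Tens n | ∃ j, 1 ≤ j ∧ j ≤ n ∧ v = ell n j}

/-- The quantum integer `[m]` for an integer `m`. -/
def qintZ (m : ℤ) : Fq := (q ^ m - q ^ (-m)) / (q - q⁻¹)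

lemma q_ne_zero : q ≠ 0 := RatFunc.X_ne_zero

lemma q_pow_ne_one {m : ℕ} (hm : m ≠ 0) : q ^ m ≠ 1 := by
  intro h
  have h' : algebraMap (Polynomial ℚ) (RatFunc ℚ) (Polynomial.X ^ m) =
      algebraMap (Polynomial ℚ) (RatFunc ℚ) 1 := by
    simpa [q, RatFunc.algebraMap_X] using h
  have hX := congrArg Polynomial.natDegree (RatFunc.algebraMap_injective ℚ h')
  simp at hX
  exact hm hX

lemma q_pow_sub_ne_zero {m : ℕ} (hm : m ≠ 0) : q ^ m - q⁻¹ ^ m ≠ 0 := by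
  intro h
  apply q_pow_ne_one (m := 2 * m) (by omega)
  have hq : q ^ m ≠ 0 := pow_ne_zero _ q_ne_zero
  rw [inv_pow, sub_eq_zero] at h
  rw [two_mul, pow_add]
  nth_rw 1 [h]
  exact inv_mul_cancel₀ hq

lemma q_sub_inv_ne_zero : q - q⁻¹ ≠ 0 := by
  simpa using q_pow_sub_ne_zero one_ne_zero

lemma qint_ne_zero {m : ℕ} (hm : m ≠ 0) : qint m ≠ 0 :=
  div_ne_zero (q_pow_sub_ne_zero hm) q_sub_inv_ne_zero

lemma qfact_ne_zero (m : ℕ) : qfact m ≠ 0 :=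
  Finset.prod_ne_zero_iff.mpr fun i _ => qint_ne_zero (Nat.succ_ne_zero i)

lemma qfact_succ (m : ℕ) : qfact (m + 1) = qfact m * qint (m + 1) :=
  Finset.prod_range_succ _ _

lemma qintZ_natCast (m : ℕ) : qintZ m = qint m := by
  simp [qintZ, qint, zpow_neg]

lemma qintZ_neg (m : ℤ) : qintZ (-m) = -qintZ m := by
  simp only [qintZ, neg_neg]
  ring

lemma qintZ_one : qintZ 1 = 1 := by
  simpa [qintZ] using div_self q_sub_inv_ne_zero

lemma qintZ_mul_add (a b : ℤ) :
    qintZ a * qintZ b + qintZ (b - a - 1) = qintZ (a + 1) * qintZ (b - 1) := by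
  have hq := q_ne_zero
  have hd := q_sub_inv_ne_zero
  have ha : q ^ a ≠ 0 := zpow_ne_zero _ hq
  have hb : q ^ b ≠ 0 := zpow_ne_zero _ hq
  have key : (q ^ a - q ^ (-a)) * (q ^ b - q ^ (-b)) +
      (q ^ (b - a - 1) - q ^ (-(b - a - 1))) * (q - q⁻¹) =
      (q ^ (a + 1) - q ^ (-(a + 1))) * (q ^ (b - 1) - q ^ (-(b - 1))) := by
    simp only [zpow_neg, zpow_sub₀ hq, zpow_add₀ hq, zpow_one]
    field_simp
    ring
  simp only [qintZ]
  rw [div_mul_div_comm, div_mul_div_comm, ← key, add_div, mul_div_mul_right _ _ hd]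

lemma kval_ne_zero (b : Bool) : kval b ≠ 0 := by
  cases b <;> simp [kval, q_ne_zero]

lemma Eop_single {n : ℕ} (s : Fin n → Bool) :
    Eop n (Pi.single s 1) = ∑ j : Fin n,
      if s j = false then (∏ r ∈ Finset.univ.filter fun r => r < j, kval (s r)) •
        (Pi.single (Function.update s j true) 1 : Tens n) else 0 := by
  ext t
  simp only [Eop, Matrix.mulVecLin_apply, Matrix.mulVec_single_one, Matrix.col_apply, Emat,
    Finset.sum_apply]
  refine Finset.sum_congr rfl fun j _ => ?_
  by_cases h : s j = false <;> simp [h, Pi.single_apply]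

lemma Fop_single {n : ℕ} (s : Fin n → Bool) :
    Fop n (Pi.single s 1) = ∑ j : Fin n,
      if s j = true then (∏ r ∈ Finset.univ.filter fun r => j < r, (kval (s r))⁻¹) •
        (Pi.single (Function.update s j false) 1 : Tens n) else 0 := by
  ext t
  simp only [Fop, Matrix.mulVecLin_apply, Matrix.mulVec_single_one, Matrix.col_apply, Fmat,
    Finset.sum_apply]
  refine Finset.sum_congr rfl fun j _ => ?_
  by_cases h : s j = true <;> simp [h, Pi.single_apply]

lemma countOnes_update_true {n : ℕ} {s : Fin n → Bool} {j : Fin n} (h : s j = false) :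
    countOnes (Function.update s j true) = countOnes s + 1 := by
  unfold countOnes
  rw [← Finset.card_insert_of_notMem (a := j) (by simp [h])]
  congr 1
  ext r
  by_cases hr : r = j <;> simp [hr]

lemma countOnes_update_false {n : ℕ} {s : Fin n → Bool} {j : Fin n} (h : s j = true) :
    countOnes (Function.update s j false) + 1 = countOnes s := by
  rw [← countOnes_update_true (j := j) (by simp), Function.update_idem, ← h,
    Function.update_eq_self]

lemma single_mem_weightSpace {n : ℕ} (s : Fin n → Bool) :
    (Pi.single s 1 : Tens n) ∈ weightSpace n (countOnes s) :=
  Submodule.subset_span ⟨s, rfl, rfl⟩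

lemma Eop_mem {n k : ℕ} {ψ : Tens n} (hψ : ψ ∈ weightSpace n k) :
    Eop n ψ ∈ weightSpace n (k + 1) := by
  suffices h : weightSpace n k ≤ (weightSpace n (k + 1)).comap (Eop n) from h hψ
  refine Submodule.span_le.mpr ?_
  rintro _ ⟨s, rfl, rfl⟩
  simp only [SetLike.mem_coe, Submodule.mem_comap, Eop_single]
  refine Submodule.sum_mem _ fun j _ => ?_
  split_ifs with h
  · rw [← countOnes_update_true h]
    exact Submodule.smul_mem _ _ (single_mem_weightSpace _)
  · exact Submodule.zero_mem _

lemma Fop_mem {n k : ℕ} {ψ : Tens n} (hψ : ψ ∈ weightSpace n (k + 1)) :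
    Fop n ψ ∈ weightSpace n k := by
  suffices h : weightSpace n (k + 1) ≤ (weightSpace n k).comap (Fop n) from h hψ
  refine Submodule.span_le.mpr ?_
  rintro _ ⟨s, hs, rfl⟩
  simp only [SetLike.mem_coe, Submodule.mem_comap, Fop_single]
  refine Submodule.sum_mem _ fun j _ => ?_
  split_ifs with h
  · rw [← Nat.succ_injective ((countOnes_update_false h).trans hs)]
    exact Submodule.smul_mem _ _ (single_mem_weightSpace _)
  · exact Submodule.zero_mem _

lemma Fop_eq_zero {n : ℕ} {ψ : Tens n} (hψ : ψ ∈ weightSpace n 0) : Fop n ψ = 0 := by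
  suffices h : weightSpace n 0 ≤ LinearMap.ker (Fop n) from h hψ
  refine Submodule.span_le.mpr ?_
  rintro _ ⟨s, hs, rfl⟩
  simp only [SetLike.mem_coe, LinearMap.mem_ker, Fop_single]
  refine Finset.sum_eq_zero fun j _ => if_neg fun h => ?_
  have := countOnes_update_false h
  omega

lemma Eop_pow_mem {n k : ℕ} (m : ℕ) {ψ : Tens n} (hψ : ψ ∈ weightSpace n k) :
    (Eop n ^ m) ψ ∈ weightSpace n (k + m) := by
  induction m with
  | zero => simpa using hψ
  | succ m ih =>
    rw [pow_succ', Module.End.mul_apply]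
    exact Eop_mem ih

lemma Fop_pow_mem {n k m : ℕ} {ψ : Tens n} (hψ : ψ ∈ weightSpace n (k + m)) :
    (Fop n ^ m) ψ ∈ weightSpace n k := by
  induction m generalizing ψ with
  | zero => simpa using hψ
  | succ m ih =>
    rw [pow_succ, Module.End.mul_apply]
    exact ih (Fop_mem hψ)

lemma prod_kval {n : ℕ} (s : Fin n → Bool) :
    ∏ r, kval (s r) = q ^ (2 * (countOnes s : ℤ) - n) := by
  have hcard := Finset.card_filter_add_card_filter_not (s := (Finset.univ : Finset (Fin n)))
    (fun r => s r = true)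
  rw [Finset.card_univ, Fintype.card_fin] at hcard
  simp only [kval, Finset.prod_ite, Finset.prod_const]
  rw [inv_pow, ← zpow_natCast, ← zpow_natCast, ← zpow_neg, ← zpow_add₀ q_ne_zero]
  congr 1
  unfold countOnes
  omega

lemma kval_sub_inv (b : Bool) :
    kval b - (kval b)⁻¹ = (if b then 1 else -1) * (q - q⁻¹) := by
  cases b <;> simp [kval]

lemma sum_sign_prod_kval {n : ℕ} (s : Fin n → Bool) :
    ∑ j : Fin n, (if s j then (1 : Fq) else -1) *
      ((∏ r ∈ Finset.univ.filter fun r => r < j, kval (s r)) *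
        ∏ r ∈ Finset.univ.filter fun r => j < r, (kval (s r))⁻¹) =
      qintZ (2 * (countOnes s : ℤ) - n) := by
  rw [qintZ, eq_div_iff q_sub_inv_ne_zero, zpow_neg, ← prod_kval, Finset.sum_mul]
  have h := Finset.prod_sub_ordered (Finset.univ : Finset (Fin n))
    (fun r => (kval (s r))⁻¹) (fun r => (kval (s r))⁻¹ - kval (s r))
  simp only [sub_sub_cancel] at h
  rw [Finset.prod_inv_distrib] at h
  rw [sub_eq_of_eq_add (h.trans (sub_eq_neg_add _ _)), ← Finset.sum_neg_distrib]
  refine Finset.sum_congr rfl fun j _ => ?_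
  linear_combination (-(∏ r ∈ Finset.univ.filter fun r => r < j, kval (s r)) *
        ∏ r ∈ Finset.univ.filter fun r => j < r, (kval (s r))⁻¹) * kval_sub_inv (s j)

lemma prod_update_of_notMem {ι α M : Type*} [DecidableEq ι] [CommMonoid M] (A : Finset ι)
    (g : α → M) (s : ι → α) {i : ι} (hi : i ∉ A) (b : α) :
    ∏ r ∈ A, g (Function.update s i b r) = ∏ r ∈ A, g (s r) :=
  Finset.prod_congr rfl fun r hr => by
    rw [Function.update_of_ne (ne_of_mem_of_not_mem hr hi)]

lemma prod_update_of_mem {ι α : Type*} [DecidableEq ι] (A : Finset ι)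
    (g : α → Fq) (s : ι → α) {i : ι} (hi : i ∈ A) (b : α) (h0 : g (s i) ≠ 0) :
    ∏ r ∈ A, g (Function.update s i b r) = g b / g (s i) * ∏ r ∈ A, g (s r) := by
  rw [← Finset.mul_prod_erase A _ hi, ← Finset.mul_prod_erase A (fun r => g (s r)) hi,
    prod_update_of_notMem _ g s (Finset.notMem_erase i A) b, Function.update_self]
  field_simp

/-- Raising at `j` and lowering at `i ≠ j` commute, including the `K`-coefficients. -/
lemma coef_raise_lower {n : ℕ} {s : Fin n → Bool} {i j : Fin n} (hi : s i = true)
    (hj : s j = false) :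
    (∏ r ∈ Finset.univ.filter fun r => i < r, (kval (s r))⁻¹) *
      (∏ r ∈ Finset.univ.filter fun r => r < j, kval (Function.update s i false r)) =
    (∏ r ∈ Finset.univ.filter fun r => r < j, kval (s r)) *
      ∏ r ∈ Finset.univ.filter fun r => i < r, (kval (Function.update s j true r))⁻¹ := by
  by_cases hij : i < j
  · rw [prod_update_of_mem _ kval s (by simpa using hij) false (kval_ne_zero _),
      prod_update_of_mem _ (fun b => (kval b)⁻¹) s (by simpa using hij) true
        (inv_ne_zero (kval_ne_zero _)), hi, hj]
    simp only [kval]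
    simp
    ring
  · rw [prod_update_of_notMem _ kval s (by simpa using hij),
      prod_update_of_notMem _ (fun b => (kval b)⁻¹) s (by simpa using hij), mul_comm]

lemma commutator_single {n : ℕ} (s : Fin n → Bool) :
    Eop n (Fop n (Pi.single s 1)) - Fop n (Eop n (Pi.single s 1)) =
      qintZ (2 * (countOnes s : ℤ) - n) • (Pi.single s 1 : Tens n) := by
  rw [Fop_single, Eop_single, map_sum, map_sum, ← sum_sign_prod_kval, Finset.sum_smul]
  have hEF : ∀ i, Eop n (if s i = true then
      (∏ r ∈ Finset.univ.filter fun r => i < r, (kval (s r))⁻¹) •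
        (Pi.single (Function.update s i false) 1 : Tens n) else 0) =
      ∑ j, ((if i = j ∧ s j = true then
        ((∏ r ∈ Finset.univ.filter fun r => r < j, kval (s r)) *
        ∏ r ∈ Finset.univ.filter fun r => j < r, (kval (s r))⁻¹) •
          (Pi.single s 1 : Tens n) else 0) +
        if s i = true ∧ s j = false then
        ((∏ r ∈ Finset.univ.filter fun r => i < r, (kval (s r))⁻¹) *
          ∏ r ∈ Finset.univ.filter fun r => r < j, kval (Function.update s i false r)) •
          (Pi.single (Function.update (Function.update s i false) j true) 1 : Tens n) else 0) := by
    intro i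
    by_cases hi : s i = true
    · rw [if_pos hi, map_smul, Eop_single, Finset.smul_sum]
      refine Finset.sum_congr rfl fun j _ => ?_
      by_cases hij : i = j
      · subst hij
        rw [prod_update_of_notMem _ kval s (by simp)]
        have hs : Function.update s i true = s := by rw [← hi, Function.update_eq_self]
        simp [hi, smul_smul, mul_comm, hs]
      · have hji : j ≠ i := fun h => hij h.symm
        by_cases hj : s j = false <;> simp [hi, hij, hji, hj, smul_smul]
    · rw [if_neg hi, map_zero]
      refine (Finset.sum_eq_zero fun j _ => ?_).symm
      rw [if_neg (by rintro ⟨rfl, h⟩; exact hi h), if_neg (fun h => hi h.1), add_zero]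
  have hFE : ∀ j, Fop n (if s j = false then
      (∏ r ∈ Finset.univ.filter fun r => r < j, kval (s r)) •
        (Pi.single (Function.update s j true) 1 : Tens n) else 0) =
      ∑ i, ((if i = j ∧ s j = false then
        ((∏ r ∈ Finset.univ.filter fun r => r < j, kval (s r)) *
        ∏ r ∈ Finset.univ.filter fun r => j < r, (kval (s r))⁻¹) •
          (Pi.single s 1 : Tens n) else 0) +
        if s i = true ∧ s j = false then
        ((∏ r ∈ Finset.univ.filter fun r => i < r, (kval (s r))⁻¹) *
          ∏ r ∈ Finset.univ.filter fun r => r < j, kval (Function.update s i false r)) •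
          (Pi.single (Function.update (Function.update s i false) j true) 1 : Tens n) else 0) := by
    intro j
    by_cases hj : s j = false
    · rw [if_pos hj, map_smul, Fop_single, Finset.smul_sum]
      refine Finset.sum_congr rfl fun i _ => ?_
      by_cases hij : i = j
      · subst hij
        rw [prod_update_of_notMem _ (fun b => (kval b)⁻¹) s (by simp)]
        have hs : Function.update s i false = s := by rw [← hj, Function.update_eq_self]
        simp [hj, smul_smul, hs]
      · by_cases hi : s i = true
        · rw [coef_raise_lower hi hj, Function.update_comm hij]
          simp [hi, hij, hj, smul_smul]
        · simp [hi, hij]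
    · rw [if_neg hj, map_zero]
      refine (Finset.sum_eq_zero fun i _ => ?_).symm
      rw [if_neg (fun h => hj h.2), if_neg (fun h => hj h.2), add_zero]
  simp only [hEF, hFE]
  rw [Finset.sum_comm, ← Finset.sum_sub_distrib]
  refine Finset.sum_congr rfl fun j _ => ?_
  rw [← Finset.sum_sub_distrib, Finset.sum_eq_single j]
  · cases s j <;> simp
  · intro i _ hij
    simp [hij]
  · simp

lemma commutator_apply {n k : ℕ} {ψ : Tens n} (hψ : ψ ∈ weightSpace n k) :
    Fop n (Eop n ψ) = Eop n (Fop n ψ) - qintZ (2 * (k : ℤ) - n) • ψ := by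
  suffices h : weightSpace n k ≤ LinearMap.eqLocus (Fop n ∘ₗ Eop n)
      (Eop n ∘ₗ Fop n - qintZ (2 * (k : ℤ) - n) • LinearMap.id) from h hψ
  refine Submodule.span_le.mpr ?_
  rintro _ ⟨s, rfl, rfl⟩
  simp only [SetLike.mem_coe, LinearMap.mem_eqLocus, LinearMap.comp_apply, LinearMap.sub_apply,
    LinearMap.smul_apply, LinearMap.id_apply]
  rw [← commutator_single, sub_sub_cancel]

lemma Fop_pow_Eop {n k m : ℕ} (hm : m ≤ k) {ψ : Tens n} (hψ : ψ ∈ weightSpace n k) :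
    (Fop n ^ (m + 1)) (Eop n ψ) = Eop n ((Fop n ^ (m + 1)) ψ) -
      (qintZ (m + 1) * qintZ (2 * (k : ℤ) - n - m)) • (Fop n ^ m) ψ := by
  induction m with
  | zero => simpa [qintZ_one] using commutator_apply hψ
  | succ m ih =>
    obtain ⟨l, rfl⟩ := Nat.exists_eq_add_of_le' hm
    have hc := commutator_apply (Fop_pow_mem hψ)
    rw [pow_succ', Module.End.mul_apply, ih (by omega), map_sub, map_smul, hc, sub_sub,
      ← Module.End.mul_apply (Fop n), ← Module.End.mul_apply (Fop n), ← pow_succ', ← pow_succ',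
      ← add_smul, add_comm (qintZ _)]
    congr 2
    have := qintZ_mul_add (m + 1) (2 * ((l + (m + 1) : ℕ) : ℤ) - n - m)
    push_cast at this ⊢
    convert this using 2 <;> ring_nf

lemma Fop_Eop_pow {n : ℕ} (m : ℕ) {φ : Tens n} (hφ : φ ∈ weightSpace n 0) :
    Fop n ((Eop n ^ (m + 1)) φ) = (qintZ (m + 1) * qintZ (n - m)) • (Eop n ^ m) φ := by
  induction m with
  | zero =>
    have h := commutator_apply hφ
    rw [Fop_eq_zero hφ, map_zero, zero_sub, ← neg_smul, ← qintZ_neg] at h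
    simpa [qintZ_one] using h
  | succ m ih =>
    have hc := commutator_apply (Eop_pow_mem (m + 1) hφ)
    rw [pow_succ', Module.End.mul_apply, hc, ih, map_smul, ← Module.End.mul_apply (Eop n),
      ← pow_succ', ← sub_smul, sub_eq_add_neg, ← qintZ_neg]
    congr 1
    have := qintZ_mul_add (m + 1) (n - m)
    push_cast at this ⊢
    convert this using 2 <;> ring_nf

lemma JW_apply (n k : ℕ) (ψ : Tens n) :
    JW n k ψ = (qfact (n - k) / (qfact n * qfact k)) • (Eop n ^ k) ((Fop n ^ k) ψ) := by
  have h1 := qfact_ne_zero n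
  have h2 := qfact_ne_zero k
  have h3 := qfact_ne_zero (n - k)
  simp only [JW, Ediv, Fdiv, qbinom, LinearMap.smul_apply, LinearMap.comp_apply, map_smul,
    smul_smul]
  congr 1
  field_simp

lemma qfact_ratio_step {n k : ℕ} (hk : k < n) :
    qfact (n - (k + 1)) / (qfact n * qfact (k + 1)) * (qintZ (k + 1) * qintZ (n - k)) =
      qfact (n - k) / (qfact n * qfact k) := by
  obtain ⟨m, rfl⟩ := Nat.exists_eq_add_of_lt hk
  have e1 : k + m + 1 - (k + 1) = m := by omega
  have e2 : k + m + 1 - k = m + 1 := by omega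
  have e3 : (((k + m + 1 : ℕ) : ℤ) - k) = ((m + 1 : ℕ) : ℤ) := by push_cast; ring
  have e4 : ((k : ℤ) + 1) = ((k + 1 : ℕ) : ℤ) := by push_cast; ring
  rw [e1, e2, e3, e4, qintZ_natCast, qintZ_natCast, qfact_succ k, qfact_succ m]
  have h1 := qfact_ne_zero (k + m + 1)
  have h2 := qfact_ne_zero k
  have h3 := qint_ne_zero (Nat.succ_ne_zero k)
  field_simp

/-- the operators `P_k` intertwine the quantum `sl₂` action:
`E ∘ P_k = P_{k+1} ∘ E` on `W_k` (for `k ≤ n-1`) and `F ∘ P_k = P_{k-1} ∘ F` on `W_k`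
(for `1 ≤ k ≤ n`). -/
theorem jones_wenzl_intertwines (n : ℕ) (hn : 1 ≤ n) :
    (∀ k, k ≤ n - 1 → ∀ ψ ∈ weightSpace n k,
      Eop n (JW n k ψ) = JW n (k + 1) (Eop n ψ)) ∧
    (∀ k, 1 ≤ k → k ≤ n → ∀ ψ ∈ weightSpace n k,
      Fop n (JW n k ψ) = JW n (k - 1) (Fop n ψ)) := by
  constructor
  · intro k hk ψ hψ
    have hF : (Fop n ^ (k + 1)) (Eop n ψ) = (qintZ (k + 1) * qintZ (n - k)) • (Fop n ^ k) ψ := by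
      rw [Fop_pow_Eop le_rfl hψ, pow_succ', Module.End.mul_apply,
        Fop_eq_zero (Fop_pow_mem (k := 0) (by simpa using hψ)), map_zero, zero_sub, ← neg_smul,
        ← mul_neg, ← qintZ_neg]
      congr 3
      ring
    rw [JW_apply, JW_apply, hF, map_smul, map_smul, smul_smul, qfact_ratio_step (by omega),
      pow_succ', Module.End.mul_apply]
  · intro k hk hkn ψ hψ
    obtain ⟨k, rfl⟩ := Nat.exists_eq_add_of_le' hk
    rw [Nat.add_sub_cancel, JW_apply, JW_apply, map_smul,
      Fop_Eop_pow k (Fop_pow_mem (k := 0) (by simpa using hψ)), smul_smul,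
      qfact_ratio_step (by omega), pow_succ, Module.End.mul_apply]
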